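/- arXiv:0806.2337 — 8 statements merged into one kernel-verified Lean document; each statement's English description precedes it below -/
import Mathlib

section
/- Every matrix Λ ∈ L with det Λ > 0 and Tr Λ > 0 can be written uniquely as Λ = n₁α₁ + n₂α₂ + n₃α₃ with n₁, n₂, n₃ nonnegative integers. -/
open Matrix

/-- The lattice L: 2×2 symmetric integer matrices with even diagonal. -/
abbrev MZ : Type := Matrix (Fin 2) (Fin 2) ℤ

def a1 : MZ := !![0,-1;-1,0]
def a2 : MZ := !![2,1;1,0]
def a3 : MZ := !![0,1;1,2]

/-- Every Λ ∈ L with det Λ > 0 and Tr Λ > 0 is uniquely a nonnegative integer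
combination n₁α₁ + n₂α₂ + n₃α₃. -/
theorem stmt2 (Λ : MZ) (hsymm : Λ.IsSymm) (h00 : Even (Λ 0 0)) (h11 : Even (Λ 1 1))
    (hdet : 0 < Λ.det) (htr : 0 < Λ.trace) :
    ∃! n : ℕ × ℕ × ℕ, Λ = (n.1 : ℤ) • a1 + (n.2.1 : ℤ) • a2 + (n.2.2 : ℤ) • a3 := by
  have hs : Λ 1 0 = Λ 0 1 := hsymm.apply 0 1
  rw [Matrix.det_fin_two, hs] at hdet
  rw [Matrix.trace_fin_two] at htr
  obtain ⟨p, hp⟩ := h00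
  obtain ⟨r, hr⟩ := h11
  have key : ∀ n : ℕ × ℕ × ℕ,
      Λ = (n.1 : ℤ) • a1 + (n.2.1 : ℤ) • a2 + (n.2.2 : ℤ) • a3 ↔
      (n.2.1 : ℤ) = p ∧ (n.2.2 : ℤ) = r ∧ (n.1 : ℤ) = p + r - Λ 0 1 := by
    intro n
    rw [← Matrix.ext_iff]
    simp only [Fin.forall_fin_two, a1, a2, a3, Matrix.add_apply, Matrix.smul_apply]
    simp [hs, hp, hr]
    omega
  rw [hp, hr] at hdet htr
  generalize Λ 0 1 = q at *
  have hpr : 0 < p * r := by nlinarith [sq_nonneg q]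
  have hp0 : 0 < p := by
    by_contra h
    nlinarith
  have hr0 : 0 < r := by
    by_contra h
    nlinarith
  have hq : 0 ≤ p + r - q := by
    by_contra h
    nlinarith [sq_nonneg (p - r)]
  refine ⟨((p + r - q).toNat, p.toNat, r.toNat), ?_, ?_⟩
  · refine (key _).2 ⟨?_, ?_, ?_⟩ <;> simp <;> omega
  · rintro ⟨x, y, z⟩ h
    obtain ⟨h1, h2, h3⟩ := (key _).1 h
    simp only [Prod.mk.injEq] at *
    omega
end

section
/- For every pair of distinct indices i ≠ j in {1,2,3}, the composition s_i ∘ s_j of the reflections s_i and s_j has infinite order as a linear map on V (i.e. no positive power of s_i ∘ s_j is the identity). -/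
open Matrix

noncomputable section

abbrev M2 : Type := Matrix (Fin 2) (Fin 2) ℝ

/-- The bilinear form (X,Y) = −(x₁₁y₂₂ + x₂₂y₁₁ − 2x₁₂y₁₂). -/
def Br (X Y : M2) : ℝ := -(X 0 0 * Y 1 1 + X 1 1 * Y 0 0 - 2 * X 0 1 * Y 0 1)

/-- The simple roots α₁, α₂, α₃. -/
def αr : Fin 3 → M2 := ![!![0,-1;-1,0], !![2,1;1,0], !![0,1;1,2]]

/-- The reflection s_i(X) = X − (X,α_i)·α_i. -/
def s (i : Fin 3) (X : M2) : M2 := X - Br X (αr i) • αr i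

theorem step_aux (i j : Fin 3) (hij : i ≠ j) (c : ℝ) :
    s i (s j (αr i + c • (αr i + αr j))) = αr i + (c + 2) • (αr i + αr j) := by
  fin_cases i <;> fin_cases j <;> first
    | exact absurd rfl hij
    | (ext a b
       fin_cases a <;> fin_cases b <;> simp [s, Br, αr] <;> ring)

theorem iter_aux (i j : Fin 3) (hij : i ≠ j) (n : ℕ) :
    (s i ∘ s j)^[n] (αr i) = αr i + (2 * n : ℝ) • (αr i + αr j) := by
  induction n with
  | zero => simp
  | succ k ih =>
    rw [Function.iterate_succ_apply', ih, Function.comp_apply, step_aux i j hij]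
    push_cast
    congr 2
    ring

theorem symm_aux (i : Fin 3) : (αr i).IsSymm := by
  ext a b
  fin_cases i <;> fin_cases a <;> fin_cases b <;> simp [αr]

theorem trace_aux (i j : Fin 3) (hij : i ≠ j) : (αr i + αr j).trace ≠ 0 := by
  fin_cases i <;> fin_cases j <;> first
    | exact absurd rfl hij
    | (simp [αr, Matrix.trace_fin_two] <;> norm_num)

/-- For i ≠ j, the composition s_i ∘ s_j has infinite order as a map on V:
no positive power of it is the identity on symmetric matrices. -/
theorem stmt3 (i j : Fin 3) (hij : i ≠ j) (n : ℕ) (hn : 0 < n) :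
    ∃ X : M2, X.IsSymm ∧ (s i ∘ s j)^[n] X ≠ X := by
  refine ⟨αr i, symm_aux i, fun h => ?_⟩
  rw [iter_aux i j hij, add_eq_left, smul_eq_zero] at h
  rcases h with h | h
  · have : (0 : ℝ) < n := by exact_mod_cast hn
    linarith
  · exact trace_aux i j hij (by rw [h, Matrix.trace_zero])
end
end

section
/- Let S = [[0,−1],[1,0]], T = [[1,1],[0,1]], R = [[1,0],[0,−1]] in GL(2,ℤ), and let PGL(2,ℤ) = GL(2,ℤ)/{±I}. Let W̄ be the subgroup of PGL(2,ℤ) generated by the classes of the three elements R, (TS)R(TS)⁻¹, and (TS)²R(TS)⁻², and let D be the subgroup of PGL(2,ℤ) generated by the classes of RS and TS. Then: (a) W̄ is a normal subgroup of PGL(2,ℤ); (b) D has order 6 and is isomorphic to the symmetric group S₃; (c) W̄ ∩ D is trivial and PGL(2,ℤ) = W̄·D, so that PGL(2,ℤ) is the (internal) semidirect product W̄ ⋊ D. In particular W̄ has index 6 in PGL(2,ℤ) and PGL(2,ℤ)/W̄ ≅ S₃. -/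
open Matrix

/-- GL(2,ℤ): the group of 2×2 integer matrices with determinant ±1. -/
abbrev G : Type := (Matrix (Fin 2) (Fin 2) ℤ)ˣ

/-- S = [[0,−1],[1,0]]. -/
def Su : G :=
  ⟨!![0,-1;1,0], !![0,1;-1,0],
    by ext i j; fin_cases i <;> fin_cases j <;>
      simp [Matrix.mul_apply, Fin.sum_univ_two, Matrix.one_apply],
    by ext i j; fin_cases i <;> fin_cases j <;>
      simp [Matrix.mul_apply, Fin.sum_univ_two, Matrix.one_apply]⟩

/-- T = [[1,1],[0,1]]. -/
def Tu : G :=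
  ⟨!![1,1;0,1], !![1,-1;0,1],
    by ext i j; fin_cases i <;> fin_cases j <;>
      simp [Matrix.mul_apply, Fin.sum_univ_two, Matrix.one_apply],
    by ext i j; fin_cases i <;> fin_cases j <;>
      simp [Matrix.mul_apply, Fin.sum_univ_two, Matrix.one_apply]⟩

/-- R = [[1,0],[0,−1]]. -/
def Ru : G :=
  ⟨!![1,0;0,-1], !![1,0;0,-1],
    by ext i j; fin_cases i <;> fin_cases j <;>
      simp [Matrix.mul_apply, Fin.sum_univ_two, Matrix.one_apply],
    by ext i j; fin_cases i <;> fin_cases j <;>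
      simp [Matrix.mul_apply, Fin.sum_univ_two, Matrix.one_apply]⟩

/-- The central subgroup {±I} of GL(2,ℤ). -/
def pm1 : Subgroup G := Subgroup.zpowers (-1 : G)

instance pm1_normal : pm1.Normal := by
  constructor
  intro x hx g
  obtain ⟨k, rfl⟩ := Subgroup.mem_zpowers_iff.mp hx
  have hc : Commute g ((-1 : G) ^ k) := (Commute.neg_one_right g).zpow_right k
  have h : g * (-1 : G) ^ k * g⁻¹ = (-1 : G) ^ k := by
    rw [hc.eq, mul_assoc]; simp
  rw [h]
  exact pm1.zpow_mem (Subgroup.mem_zpowers _) k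

/-- PGL(2,ℤ) = GL(2,ℤ)/{±I}. -/
abbrev PGL : Type := G ⧸ pm1

/-- The quotient map GL(2,ℤ) → PGL(2,ℤ). -/
def q (g : G) : PGL := QuotientGroup.mk g

/-- W̄: the subgroup of PGL(2,ℤ) generated by the classes of R, (TS)R(TS)⁻¹ and
(TS)²R(TS)⁻². -/
def Wbar : Subgroup PGL :=
  Subgroup.closure {q Ru, q ((Tu * Su) * Ru * (Tu * Su)⁻¹),
    q ((Tu * Su) ^ 2 * Ru * ((Tu * Su) ^ 2)⁻¹)}

/-- D: the subgroup of PGL(2,ℤ) generated by the classes of RS and TS. -/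
def Dgrp : Subgroup PGL := Subgroup.closure {q (Ru * Su), q (Tu * Su)}


section Abstract
variable {P : Type*} [Group P]

lemma abs_normal (r a t : P) (ha : a * a = 1) (ht : t ^ 3 = 1)
    (har : a * r * a = r) (hat : a * t * a = t⁻¹)
    (htop : Subgroup.closure {r, a, t} = ⊤) :
    (Subgroup.closure {r, t * r * t⁻¹, t ^ 2 * r * (t ^ 2)⁻¹}).Normal := by
  set W := Subgroup.closure {r, t * r * t⁻¹, t ^ 2 * r * (t ^ 2)⁻¹} with hW
  have m0 : r ∈ W := Subgroup.subset_closure (by simp)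
  have m1 : t * r * t⁻¹ ∈ W := Subgroup.subset_closure (by simp)
  have m2 : t ^ 2 * r * (t ^ 2)⁻¹ ∈ W := Subgroup.subset_closure (by simp)
  have ha' : a⁻¹ = a := inv_eq_of_mul_eq_one_left ha
  have ht' : t⁻¹ = t ^ 2 := inv_eq_of_mul_eq_one_left (by rw [← ht]; simp only [pow_succ, pow_zero, one_mul, mul_assoc])
  have ht2 : (t ^ 2)⁻¹ = t := by rw [← ht']; simp
  have key : ∀ g : P, g * r * g⁻¹ ∈ W → g * (t * r * t⁻¹) * g⁻¹ ∈ W →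
      g * (t ^ 2 * r * (t ^ 2)⁻¹) * g⁻¹ ∈ W → ∀ w ∈ W, g * w * g⁻¹ ∈ W := by
    intro g h0 h1 h2 w hw
    have : W ≤ W.comap (MulAut.conj g).toMonoidHom := by
      conv_lhs => rw [hW]
      rw [Subgroup.closure_le]
      rintro x (rfl | rfl | rfl)
      · simpa using h0
      · simpa using h1
      · simpa using h2
    simpa using this hw
  have hr : ∀ w ∈ W, r * w * r⁻¹ ∈ W := fun w hw =>
    W.mul_mem (W.mul_mem m0 hw) (W.inv_mem m0)
  have hr' : ∀ w ∈ W, r⁻¹ * w * r ∈ W := fun w hw =>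
    W.mul_mem (W.mul_mem (W.inv_mem m0) hw) m0
  have hA : ∀ w ∈ W, a * w * a⁻¹ ∈ W := by
    have e1 : a * t = t⁻¹ * a := by rw [← hat, mul_assoc _ a a, ha, mul_one]
    have e1' : t⁻¹ * a = a * t := e1.symm
    have e2 : a * t⁻¹ = t * a := by
      rw [← hat]
      calc a * (a * t * a) = (a * a) * t * a := by group
        _ = t * a := by rw [ha]; group
    apply key
    · rw [ha', har]; exact m0
    · have : a * (t * r * t⁻¹) * a⁻¹ = t ^ 2 * r * (t ^ 2)⁻¹ := by
        calc a * (t * r * t⁻¹) * a⁻¹ = (a * t) * r * (t⁻¹ * a) := by rw [ha']; group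
          _ = t⁻¹ * (a * r * a) * t := by rw [e1', e1]; nth_rw 2 [e1']; group
          _ = t ^ 2 * r * (t ^ 2)⁻¹ := by rw [har, ht2, ht']
      rw [this]; exact m2
    · have : a * (t ^ 2 * r * (t ^ 2)⁻¹) * a⁻¹ = t * r * t⁻¹ := by
        calc a * (t ^ 2 * r * (t ^ 2)⁻¹) * a⁻¹ = (a * t⁻¹) * r * (t * a) := by
              rw [ha', ht2, ht']; group
          _ = t * (a * r * a) * t⁻¹ := by rw [e2]; simp only [mul_assoc]; rw [← e2]
          _ = t * r * t⁻¹ := by rw [har]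
      rw [this]; exact m1
  have hT : ∀ w ∈ W, t * w * t⁻¹ ∈ W := by
    apply key
    · exact m1
    · convert m2 using 1; rw [pow_two]; group
    · have : t * (t ^ 2 * r * (t ^ 2)⁻¹) * t⁻¹ = t ^ 3 * r * (t ^ 3)⁻¹ := by group
      rw [this, ht]; simpa using m0
  have hT' : ∀ w ∈ W, t⁻¹ * w * t ∈ W := by
    intro w hw
    have := hT _ (hT w hw)
    convert this using 1
    calc t⁻¹ * w * t = t ^ 2 * w * (t ^ 2)⁻¹ := by rw [ht2, ht']
      _ = _ := by rw [pow_two]; group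
  have main : ∀ g : P, ∀ w ∈ W, g * w * g⁻¹ ∈ W ∧ g⁻¹ * w * g ∈ W := by
    intro g
    have hg : g ∈ Subgroup.closure {r, a, t} := by rw [htop]; trivial
    induction hg using Subgroup.closure_induction with
    | mem x hx =>
      intro w hw
      rcases hx with rfl | rfl | rfl
      · exact ⟨hr w hw, hr' w hw⟩
      · refine ⟨hA w hw, ?_⟩
        have := hA w hw
        rwa [ha'] at this ⊢
      · exact ⟨hT w hw, hT' w hw⟩
    | one => intro w hw; simpa using hw
    | mul x y _ _ hx hy =>
      intro w hw
      constructor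
      · have := (hx _ (hy w hw).1).1
        convert this using 1; group
      · have := (hy _ (hx w hw).2).2
        convert this using 1; group
    | inv x _ hx =>
      intro w hw
      exact ⟨by simpa using (hx w hw).2, by simpa using (hx w hw).1⟩
  exact ⟨fun w hw g => (main g w hw).1⟩

lemma abs_D (a t : P) (ha : a * a = 1) (ht : t ^ 3 = 1) (hat : a * t * a = t⁻¹) :
    ∀ d ∈ Subgroup.closure {a, t}, ∃ i : Fin 3, ∃ j : Fin 2, d = t ^ (i : ℕ) * a ^ (j : ℕ) := by
  have ht' : t⁻¹ = t * t := inv_eq_of_mul_eq_one_left (by rw [← ht]; simp only [pow_succ, pow_zero, one_mul, mul_assoc])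
  have ha' : a⁻¹ = a := inv_eq_of_mul_eq_one_left ha
  have ht3 : t * (t * t) = 1 := by rw [← ht]; simp only [pow_succ, pow_zero, one_mul, mul_assoc]
  have e1 : a * t = t * (t * a) := by
    rw [← mul_assoc, ← ht', ← hat, mul_assoc _ a a, ha, mul_one]
  have ha1 : ∀ x, a * (a * x) = x := fun x => by rw [← mul_assoc, ha, one_mul]
  have ht1 : ∀ x, t * (t * (t * x)) = x := fun x => by
    have := congrArg (· * x) ht3; simpa [mul_assoc] using this
  have e1x : ∀ x, a * (t * x) = t * (t * (a * x)) := fun x => by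
    rw [← mul_assoc, e1]; simp only [mul_assoc]
  have neg2 : ((-2 : Fin 3) : ℕ) = 1 := rfl
  intro d hd
  induction hd using Subgroup.closure_induction_left with
  | one => exact ⟨0, 0, by simp⟩
  | mul_left x hx y _ ih =>
    obtain ⟨i, j, rfl⟩ := ih
    rcases hx with rfl | rfl
    · refine ⟨-i, j + 1, ?_⟩
      fin_cases i <;> fin_cases j <;> simp [pow_succ, mul_assoc, e1, ha, ht1, ht3, e1x, neg2]
    · refine ⟨i + 1, j, ?_⟩
      fin_cases i <;> fin_cases j <;> simp [pow_succ, mul_assoc, e1, ha, ht1, ht3, e1x, neg2]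
  | inv_mul_cancel x hx y _ ih =>
    obtain ⟨i, j, rfl⟩ := ih
    rcases hx with rfl | rfl
    · refine ⟨-i, j + 1, ?_⟩
      rw [ha']
      fin_cases i <;> fin_cases j <;> simp [pow_succ, mul_assoc, e1, ha, ht1, ht3, e1x, neg2]
    · refine ⟨i + 2, j, ?_⟩
      rw [ht']
      fin_cases i <;> fin_cases j <;> simp [pow_succ, mul_assoc, e1, ha, ht1, ht3, e1x, neg2]

lemma abs_main (r a t : P) (ha : a * a = 1) (ht : t ^ 3 = 1)
    (har : a * r * a = r) (hat : a * t * a = t⁻¹)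
    (htop : Subgroup.closure {r, a, t} = ⊤)
    (φ : P →* Equiv.Perm (Fin 3)) (hr : φ r = 1)
    (h1 : ∀ i : Fin 3, ∀ j : Fin 2, φ t ^ (i : ℕ) * φ a ^ (j : ℕ) = 1 → i = 0 ∧ j = 0)
    (h2 : ∀ σ, ∃ i : Fin 3, ∃ j : Fin 2, σ = φ t ^ (i : ℕ) * φ a ^ (j : ℕ))
    (W D : Subgroup P) (hW : W = Subgroup.closure {r, t * r * t⁻¹, t ^ 2 * r * (t ^ 2)⁻¹})
    (hD : D = Subgroup.closure {a, t}) :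
    W.Normal ∧
    (Nat.card D = 6 ∧ Nonempty (D ≃* Equiv.Perm (Fin 3))) ∧
    (W ⊓ D = ⊥ ∧ (∀ g : P, ∃ w ∈ W, ∃ d ∈ D, g = w * d)) ∧
    W.index = 6 ∧
    ∃ φ : P →* Equiv.Perm (Fin 3), Function.Surjective φ ∧ φ.ker = W := by
  have hN : W.Normal := by rw [hW]; exact abs_normal r a t ha ht har hat htop
  have aD : a ∈ D := by rw [hD]; exact Subgroup.subset_closure (by simp)
  have tD : t ∈ D := by rw [hD]; exact Subgroup.subset_closure (by simp)
  have rW : r ∈ W := by rw [hW]; exact Subgroup.subset_closure (by simp)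
  have hWk : W ≤ φ.ker := by
    rw [hW, Subgroup.closure_le]
    rintro x (rfl | rfl | rfl) <;> simp [MonoidHom.mem_ker, hr]
  have hDk : ∀ d ∈ D, φ d = 1 → d = 1 := by
    intro d hd h
    rw [hD] at hd
    obtain ⟨i, j, rfl⟩ := abs_D a t ha ht hat d hd
    obtain ⟨rfl, rfl⟩ := h1 i j (by simpa using h)
    simp
  have hsup : W ⊔ D = ⊤ := by
    rw [eq_top_iff, ← htop, Subgroup.closure_le]
    rintro x (rfl | rfl | rfl)
    · exact (le_sup_left : W ≤ W ⊔ D) rW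
    · exact (le_sup_right : D ≤ W ⊔ D) aD
    · exact (le_sup_right : D ≤ W ⊔ D) tD
  have hWD : ∀ g : P, ∃ w ∈ W, ∃ d ∈ D, g = w * d := by
    intro g
    have : g ∈ W ⊔ D := by rw [hsup]; trivial
    obtain ⟨w, hw, d, hd, h⟩ := Subgroup.mem_sup_of_normal_left.mp this
    exact ⟨w, hw, d, hd, h.symm⟩
  have hs : ∀ σ, ∃ d ∈ D, φ d = σ := by
    intro σ
    obtain ⟨i, j, rfl⟩ := h2 σ
    exact ⟨t ^ (i : ℕ) * a ^ (j : ℕ), D.mul_mem (D.pow_mem tD _) (D.pow_mem aD _), by simp⟩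
  have hker : φ.ker = W := by
    refine le_antisymm ?_ hWk
    intro g hg
    obtain ⟨w, hw, d, hd, rfl⟩ := hWD g
    have hw1 : φ w = 1 := hWk hw
    have : φ d = 1 := by simpa [MonoidHom.mem_ker, hw1] using hg
    rw [hDk d hd this, mul_one]; exact hw
  have hsurj : Function.Surjective φ := fun σ => by
    obtain ⟨d, _, h⟩ := hs σ
    exact ⟨d, h⟩
  have e : D ≃* Equiv.Perm (Fin 3) := MulEquiv.ofBijective (φ.comp D.subtype) (by
    constructor
    · rw [injective_iff_map_eq_one]
      rintro ⟨d, hd⟩ h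
      exact Subtype.ext (hDk d hd h)
    · intro σ
      obtain ⟨d, hd, h⟩ := hs σ
      exact ⟨⟨d, hd⟩, h⟩)
  have hc : Nat.card (Equiv.Perm (Fin 3)) = 6 := by
    simp [Nat.card_eq_fintype_card, Fintype.card_perm, Nat.factorial]
  refine ⟨hN, ⟨by rw [Nat.card_congr e.toEquiv, hc], ⟨e⟩⟩, ⟨?_, hWD⟩, ?_, φ, hsurj, hker⟩
  · rw [eq_bot_iff]
    rintro x ⟨hx, hx'⟩
    exact hDk x hx' (hWk hx)
  · rw [← hker, Subgroup.index_ker, MonoidHom.range_eq_top.mpr hsurj, ← hc]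
    exact Nat.card_congr (Equiv.Set.univ _)

end Abstract

/-! The action of GL(2, F₂) on the three nonzero vectors. -/

def vecOf (i : Fin 3) : Fin 2 → ZMod 2 := if i = 0 then ![1, 0] else if i = 1 then ![0, 1] else ![1, 1]

def idxOf (v : Fin 2 → ZMod 2) : Fin 3 := if v 1 = 0 then 0 else if v 0 = 0 then 1 else 2

def actF (M : Matrix (Fin 2) (Fin 2) (ZMod 2)) (i : Fin 3) : Fin 3 := idxOf (M *ᵥ vecOf i)

lemma vec_idx : ∀ v : Fin 2 → ZMod 2, v ≠ 0 → vecOf (idxOf v) = v := by decide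

lemma idx_vec : ∀ i, idxOf (vecOf i) = i := by decide

lemma vec_ne : ∀ i, vecOf i ≠ 0 := by decide

lemma actF_mul (M N : (Matrix (Fin 2) (Fin 2) (ZMod 2))ˣ) (i : Fin 3) :
    actF (M * N : Matrix (Fin 2) (Fin 2) (ZMod 2)) i = actF M (actF N i) := by
  unfold actF
  rw [vec_idx, Matrix.mulVec_mulVec]
  intro h
  apply vec_ne i
  have : (N⁻¹ : (Matrix (Fin 2) (Fin 2) (ZMod 2))ˣ).1 *ᵥ (N.1 *ᵥ vecOf i) = 0 := by
    rw [h, Matrix.mulVec_zero]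
  rwa [Matrix.mulVec_mulVec, Units.inv_mul, Matrix.one_mulVec] at this

lemma actF_one (i : Fin 3) : actF 1 i = i := by
  simp [actF, idx_vec]

def permHom : (Matrix (Fin 2) (Fin 2) (ZMod 2))ˣ →* Equiv.Perm (Fin 3) where
  toFun u := ⟨actF u.1, actF (u⁻¹).1,
    fun i => by rw [← actF_mul, Units.inv_mul, actF_one],
    fun i => by rw [← actF_mul, Units.mul_inv, actF_one]⟩
  map_one' := by ext i; simp [actF_one]
  map_mul' u v := by ext i; simp [actF_mul]

def redHom : G →* Equiv.Perm (Fin 3) :=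
  permHom.comp (Units.map ((Int.castRingHom (ZMod 2)).mapMatrix).toMonoidHom)

lemma redHom_apply (g : G) (i : Fin 3) :
    redHom g i = actF (g.1.map (Int.castRingHom (ZMod 2))) i := rfl

lemma redHom_neg : pm1 ≤ redHom.ker := by
  rw [pm1, Subgroup.zpowers_le, MonoidHom.mem_ker]
  ext i
  rw [redHom_apply]
  have : ((-1 : G).1.map (Int.castRingHom (ZMod 2))) = 1 := by
    ext i j; fin_cases i <;> fin_cases j <;> simp
  rw [this, actF_one]; rfl

def phi : PGL →* Equiv.Perm (Fin 3) := QuotientGroup.lift pm1 redHom redHom_neg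

lemma phi_q (g : G) : phi (q g) = redHom g := rfl

lemma q_mul (g h : G) : q (g * h) = q g * q h := rfl

lemma q_inv (g : G) : q g⁻¹ = (q g)⁻¹ := rfl

lemma q_pow (g : G) (n : ℕ) : q (g ^ n) = q g ^ n := rfl

lemma q_neg (g : G) : q (-g) = q g := by
  unfold q
  rw [QuotientGroup.eq]
  have : (-g)⁻¹ * g = -1 := by simp
  rw [this]
  exact Subgroup.mem_zpowers _

lemma red_R : redHom Ru = 1 := by
  ext i; rw [redHom_apply]; fin_cases i <;> decide

lemma red_a : redHom (Ru * Su) = Equiv.swap 0 1 := by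
  ext i; rw [redHom_apply]; fin_cases i <;> decide

lemma red_t : redHom (Tu * Su) = Equiv.swap 0 2 * Equiv.swap 1 2 := by
  ext i; rw [redHom_apply]; fin_cases i <;> decide

lemma gen_G (g : G) : g ∈ Subgroup.closure {Ru, Su, Tu} := by
  have hR : Ru ∈ Subgroup.closure {Ru, Su, Tu} := Subgroup.subset_closure (by simp)
  have hsl : ∀ g : G, g.1.det = 1 → g ∈ Subgroup.closure {Ru, Su, Tu} := by
    intro g hg
    let f : SpecialLinearGroup (Fin 2) ℤ →* G := SpecialLinearGroup.toGL
    have hle : (⊤ : Subgroup (SpecialLinearGroup (Fin 2) ℤ)) ≤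
        (Subgroup.closure {Ru, Su, Tu}).comap f := by
      rw [← SpecialLinearGroup.SL2Z_generators, Subgroup.closure_le]
      rintro x (rfl | rfl)
      · have : f ModularGroup.S = Su := Units.ext rfl
        simp only [Subgroup.coe_comap, Set.mem_preimage, this]
        exact Subgroup.subset_closure (by simp)
      · have : f ModularGroup.T = Tu := Units.ext rfl
        simp only [Subgroup.coe_comap, Set.mem_preimage, this]
        exact Subgroup.subset_closure (by simp)
    let γ : SpecialLinearGroup (Fin 2) ℤ := ⟨g.1, hg⟩
    have h : f γ ∈ Subgroup.closure {Ru, Su, Tu} := hle (Subgroup.mem_top γ)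
    have e : f γ = g := Units.ext rfl
    rwa [e] at h
  have hu : IsUnit g.1.det := (Matrix.isUnit_iff_isUnit_det _).mp g.isUnit
  rcases Int.isUnit_iff.mp hu with h | h
  · exact hsl g h
  · have h2 := hsl (Ru * g) (by
      rw [Units.val_mul, Matrix.det_mul, h]; simp [Ru, Matrix.det_fin_two])
    exact (Subgroup.mul_mem_cancel_left _ hR).mp h2

lemma gen_PGL : Subgroup.closure {q Ru, q (Ru * Su), q (Tu * Su)} = ⊤ := by
  set K := Subgroup.closure {q Ru, q (Ru * Su), q (Tu * Su)} with hK
  have kR : q Ru ∈ K := Subgroup.subset_closure (by simp)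
  have kA : q (Ru * Su) ∈ K := Subgroup.subset_closure (by simp)
  have kT : q (Tu * Su) ∈ K := Subgroup.subset_closure (by simp)
  have kS : q Su ∈ K := (Subgroup.mul_mem_cancel_left _ kR).mp kA
  have kT' : q Tu ∈ K := (Subgroup.mul_mem_cancel_right _ kS).mp kT
  rw [eq_top_iff]
  rintro x -
  obtain ⟨g, rfl⟩ := QuotientGroup.mk_surjective x
  have : Subgroup.closure {Ru, Su, Tu} ≤ K.comap (QuotientGroup.mk' pm1) := by
    rw [Subgroup.closure_le]
    rintro x (rfl | rfl | rfl)
    · exact kR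
    · exact kS
    · exact kT'
  exact this (gen_G g)

/-- (a) W̄ is normal in PGL(2,ℤ); (b) D has order 6 and D ≅ S₃; (c) W̄ ∩ D is trivial and
PGL(2,ℤ) = W̄·D, i.e. PGL(2,ℤ) = W̄ ⋊ D; in particular W̄ has index 6 and
PGL(2,ℤ)/W̄ ≅ S₃ (stated via a surjective homomorphism with kernel W̄). -/
theorem stmt4 :
    Wbar.Normal ∧
    (Nat.card Dgrp = 6 ∧ Nonempty (Dgrp ≃* Equiv.Perm (Fin 3))) ∧
    (Wbar ⊓ Dgrp = ⊥ ∧ (∀ g : PGL, ∃ w ∈ Wbar, ∃ d ∈ Dgrp, g = w * d)) ∧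
    Wbar.index = 6 ∧
    ∃ φ : PGL →* Equiv.Perm (Fin 3), Function.Surjective φ ∧ φ.ker = Wbar := by
  refine abs_main (q Ru) (q (Ru * Su)) (q (Tu * Su)) ?_ ?_ ?_ ?_ gen_PGL phi red_R ?_ ?_
    Wbar Dgrp rfl rfl
  · have : (Ru * Su) * (Ru * Su) = 1 := Units.ext (by decide)
    rw [← q_mul, this]; rfl
  · have : (Tu * Su) ^ 3 = -1 := Units.ext (by decide)
    rw [← q_pow, this, q_neg]; rfl
  · have : (Ru * Su) * Ru * (Ru * Su) = -Ru := Units.ext (by decide)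
    rw [← q_mul, ← q_mul, this, q_neg]
  · have : (Ru * Su) * (Tu * Su) * (Ru * Su) = (Tu * Su)⁻¹ := Units.ext (by decide)
    rw [← q_mul, ← q_mul, this, q_inv]
  · rw [phi_q, phi_q, red_a, red_t]; decide
  · rw [phi_q, phi_q, red_a, red_t]; decide
end

section
/- For every X ∈ V⁺ (i.e. every real symmetric 2×2 matrix with Tr X > 0 and det X > 0), at most one of the three indices i ∈ {1,2,3} satisfies (X, α_i) > 0. -/
open Matrix

noncomputable section

/-- For X in the future light-cone V⁺, at most one index i satisfies (X, α_i) > 0. -/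
theorem stmt8 (X : M2) (hs : X.IsSymm) (ht : 0 < X.trace) (hd : 0 < X.det)
    (i j : Fin 3) (hi : 0 < Br X (αr i)) (hj : 0 < Br X (αr j)) : i = j := by
  have h10 : X 1 0 = X 0 1 := hs.apply 0 1
  rw [Matrix.trace_fin_two] at ht
  rw [Matrix.det_fin_two, h10] at hd
  have hp : 0 < X 0 0 * X 1 1 := by nlinarith [mul_self_nonneg (X 0 1)]
  have ha : 0 < X 0 0 := by
    by_contra h
    nlinarith [mul_self_nonneg (X 0 0)]
  have hb : 0 < X 1 1 := by
    by_contra h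
    nlinarith [mul_self_nonneg (X 1 1)]
  fin_cases i <;> fin_cases j <;> first
    | rfl
    | (exfalso
       simp [Br, αr] at hi hj
       first
         | linarith
         | nlinarith)
end
end

section
/- Let α ∈ L with det α = −1. Then there exists exactly one unordered pair {α⁺, α⁻} of symmetric 2×2 matrices with integer entries satisfying all of: det α⁺ = det α⁻ = 0, Tr α⁺ > 0, Tr α⁻ > 0, (α, α⁺) = (α, α⁻) = 0, and (α⁺, α⁻) = −1. -/
open Matrix

/-- Factorisation of the binary form attached to `α`. -/
lemma factor_aux (a c k : ℤ) (h : a * c = k * (k + 1)) :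
    ∃ r s t u : ℤ, a = s * u ∧ c = r * t ∧ k = s * t ∧ k + 1 = r * u := by
  by_cases ha : a = 0
  · subst ha
    have h' : k * (k + 1) = 0 := by rw [← h]; ring
    rcases mul_eq_zero.mp h' with hk | hk
    · exact ⟨1, 0, c, 1, by ring, by ring, by rw [hk]; ring, by rw [hk]; ring⟩
    · exact ⟨-c, 1, -1, 0, by ring, by ring, by linarith, by rw [hk]; ring⟩
  · obtain ⟨s, u, ⟨t, ht⟩, ⟨r, hr⟩, hsu⟩ := exists_dvd_and_dvd_of_dvd_mul (Dvd.intro c h)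
    refine ⟨r, s, t, u, hsu, ?_, ht, by rw [hr]; ring⟩
    apply mul_left_cancel₀ ha
    rw [h, hr, ht, hsu]; ring

/-- Isotropic vectors orthogonal to `α` with positive trace lie on two rays. -/
lemma ray_aux (r s t u x y z : ℤ) (hd : r * u - s * t = 1) (hxz : x * z = y * y)
    (htr : 0 < x + z) (ho : s * u * z + r * t * x - (r * u + s * t) * y = 0) :
    ∃ l : ℤ, 0 < l ∧ ((x = l * (s * s) ∧ y = l * (s * r) ∧ z = l * (r * r)) ∨
      (x = l * (u * u) ∧ y = l * (u * t) ∧ z = l * (t * t))) := by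
  obtain ⟨P, hP⟩ : ∃ P, P = r * r * x - 2 * r * s * y + s * s * z := ⟨_, rfl⟩
  obtain ⟨Q, hQ⟩ : ∃ Q, Q = t * t * x - 2 * t * u * y + u * u * z := ⟨_, rfl⟩
  have hd2 : (r * u - s * t) ^ 2 = 1 := by rw [hd]; rfl
  have hx : x = P * (u * u) + Q * (s * s) := by
    have : x * (r * u - s * t) ^ 2 = P * (u * u) + Q * (s * s)
        - 2 * s * u * (s * u * z + r * t * x - (r * u + s * t) * y) := by rw [hP, hQ]; ring
    rw [hd2, ho] at this; linarith
  have hy : y = P * (u * t) + Q * (s * r) := by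
    have : y * (r * u - s * t) ^ 2 = P * (u * t) + Q * (s * r)
        - (r * u + s * t) * (s * u * z + r * t * x - (r * u + s * t) * y) := by rw [hP, hQ]; ring
    rw [hd2, ho] at this; linarith
  have hz : z = P * (t * t) + Q * (r * r) := by
    have : z * (r * u - s * t) ^ 2 = P * (t * t) + Q * (r * r)
        - 2 * r * t * (s * u * z + r * t * x - (r * u + s * t) * y) := by rw [hP, hQ]; ring
    rw [hd2, ho] at this; linarith
  have hPQ : P * Q = 0 := by
    have : P * Q = (s * u * z + r * t * x - (r * u + s * t) * y) ^ 2
        + (r * u - s * t) ^ 2 * (x * z - y * y) := by rw [hP, hQ]; ring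
    rw [this, ho, hxz]; ring
  rcases mul_eq_zero.mp hPQ with h0 | h0
  · rw [h0] at hx hy hz
    refine ⟨Q, ?_, Or.inl ⟨by linarith, by linarith, by linarith⟩⟩
    by_contra hn
    nlinarith [mul_self_nonneg s, mul_self_nonneg r]
  · rw [h0] at hx hy hz
    refine ⟨P, ?_, Or.inr ⟨by linarith, by linarith, by linarith⟩⟩
    by_contra hn
    nlinarith [mul_self_nonneg u, mul_self_nonneg t]

lemma one_aux (l n : ℤ) (hl : 0 < l) (h : l * n = 1) : l = 1 ∧ n = 1 := by
  rcases Int.mul_eq_one_iff_eq_one_or_neg_one.mp h with h | h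
  · exact h
  · omega

lemma pos_aux (r s t u : ℤ) (hd : r * u - s * t = 1) : 0 < s * s + r * r := by
  by_contra hn
  have hs : s = 0 := by nlinarith [mul_self_nonneg s, mul_self_nonneg r]
  have hr : r = 0 := by nlinarith [mul_self_nonneg s, mul_self_nonneg r]
  rw [hs, hr] at hd; simp at hd


/-- The bilinear form (X,Y) = −(x₁₁y₂₂ + x₂₂y₁₁ − 2x₁₂y₁₂) on integer symmetric
matrices, so that (X,X) = −2·det X. -/
def BZ (X Y : MZ) : ℤ := -(X 0 0 * Y 1 1 + X 1 1 * Y 0 0 - 2 * X 0 1 * Y 0 1)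

/-- For α ∈ L (symmetric, integer, even diagonal) with det α = −1 there is exactly one
unordered pair {α⁺, α⁻} of symmetric integer matrices with det α± = 0, Tr α± > 0,
(α,α⁺) = (α,α⁻) = 0 and (α⁺,α⁻) = −1. -/
theorem stmt10 (α : MZ) (hsymm : α.IsSymm) (h00 : Even (α 0 0)) (h11 : Even (α 1 1))
    (hdet : α.det = -1) :
    ∃ p m : MZ,
      (p.IsSymm ∧ m.IsSymm ∧ p.det = 0 ∧ m.det = 0 ∧ 0 < p.trace ∧ 0 < m.trace ∧
        BZ α p = 0 ∧ BZ α m = 0 ∧ BZ p m = -1) ∧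
      ∀ p' m' : MZ,
        (p'.IsSymm ∧ m'.IsSymm ∧ p'.det = 0 ∧ m'.det = 0 ∧ 0 < p'.trace ∧ 0 < m'.trace ∧
          BZ α p' = 0 ∧ BZ α m' = 0 ∧ BZ p' m' = -1) →
        (p' = p ∧ m' = m) ∨ (p' = m ∧ m' = p) := by
  have hs := hsymm.apply 0 1
  obtain ⟨a, ha⟩ := h00
  obtain ⟨c, hc⟩ := h11
  rw [Matrix.det_fin_two, hs, ha, hc] at hdet
  have hodd : Odd (α 0 1) := by
    have h : Odd (α 0 1 * α 0 1) := ⟨2 * (a * c), by linarith⟩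
    exact (Int.odd_mul.mp h).1
  obtain ⟨k, hk⟩ := hodd
  rw [hk] at hdet
  obtain ⟨r, s, t, u, hsu, hrt, hst, hru⟩ := factor_aux a c k (by linarith)
  have hd : r * u - s * t = 1 := by linarith
  have hb : α 0 1 = r * u + s * t := by linarith
  have hd2 : (r * u - s * t) ^ 2 = 1 := by rw [hd]; rfl
  refine ⟨!![s * s, s * r; s * r, r * r], !![u * u, u * t; u * t, t * t], ?_, ?_⟩
  · refine ⟨?_, ?_, ?_, ?_, ?_, ?_, ?_, ?_, ?_⟩
    · ext i j; fin_cases i <;> fin_cases j <;> rfl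
    · ext i j; fin_cases i <;> fin_cases j <;> rfl
    · rw [Matrix.det_fin_two_of]; ring
    · rw [Matrix.det_fin_two_of]; ring
    · rw [Matrix.trace_fin_two_of]; exact pos_aux r s t u hd
    · rw [Matrix.trace_fin_two_of]; exact pos_aux (-t) u (-r) s (by linarith) |>.trans_eq (by ring)
    · simp only [BZ, ha, hc, hb, hsu, hrt]; simp; ring
    · simp only [BZ, ha, hc, hb, hsu, hrt]; simp; ring
    · simp [BZ]; linarith
  · rintro p m ⟨hp, hm, hpd, hmd, hpt, hmt, hap, ham, hpm⟩
    have hps := hp.apply 0 1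
    have hms := hm.apply 0 1
    rw [Matrix.det_fin_two, hps] at hpd
    rw [Matrix.det_fin_two, hms] at hmd
    rw [Matrix.trace_fin_two] at hpt hmt
    simp only [BZ, ha, hc, hb, hsu, hrt] at hap ham hpm
    obtain ⟨l, hl, hL⟩ := ray_aux r s t u (p 0 0) (p 0 1) (p 1 1) hd (by linarith) hpt
      (by linarith)
    obtain ⟨n, hn, hN⟩ := ray_aux r s t u (m 0 0) (m 0 1) (m 1 1) hd (by linarith) hmt
      (by linarith)
    rcases hL with ⟨h1, h2, h3⟩ | ⟨h1, h2, h3⟩ <;> rcases hN with ⟨h4, h5, h6⟩ | ⟨h4, h5, h6⟩ <;>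
      rw [h1, h2, h3, h4, h5, h6] at hpm
    · exfalso; ring_nf at hpm; omega
    · left
      obtain ⟨rfl, rfl⟩ := one_aux l n hl (by
        have : l * n * (r * u - s * t) ^ 2 = 1 := by linarith
        rwa [hd2, mul_one] at this)
      constructor <;> ext i j <;> fin_cases i <;> fin_cases j <;> simp [*]
    · right
      obtain ⟨rfl, rfl⟩ := one_aux l n hl (by
        have : l * n * (r * u - s * t) ^ 2 = 1 := by linarith
        rwa [hd2, mul_one] at this)
      constructor <;> ext i j <;> fin_cases i <;> fin_cases j <;> simp [*]
    · exfalso; ring_nf at hpm; omega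
end

section
/- Let α ∈ L with det α = −1, and let {α⁺, α⁻} be the unique pair of integer symmetric 2×2 matrices with det α± = 0, Tr α± > 0, (α,α⁺) = (α,α⁻) = 0 and (α⁺,α⁻) = −1. Then every Λ ∈ L can be written uniquely as Λ = p·α⁺ + q·α⁻ + r·α with integers p, q, r, and det Λ = pq − r². Moreover, if det Λ > 0 and Tr Λ > 0, then p > 0, q > 0 and pq > r². -/
open Matrix

/-- A positive definite form pairs positively with a nonzero nonnegative lightlike one. -/
lemma pair_pos (m l n u v w : ℤ) (hd : 0 < m * n - l ^ 2) (ht : 0 < m + n)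
    (h0 : u * w - v ^ 2 = 0) (hu : 0 < u + w) : 0 < m * w + n * u - 2 * l * v := by
  have hmn : 0 < m * n := by nlinarith [sq_nonneg l]
  have hm : 0 < m := by
    by_contra h
    have : 0 < n := by omega
    nlinarith
  have huw : 0 ≤ u * w := by nlinarith [sq_nonneg v]
  have hu0 : 0 ≤ u := by
    by_contra h
    have : 0 < w := by omega
    nlinarith
  rcases hu0.lt_or_eq with h | h
  · have key : m * u * (m * w + n * u - 2 * l * v)
        = (m * v - l * u) ^ 2 + (m * n - l ^ 2) * u ^ 2 := by
      linear_combination m ^ 2 * h0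
    have h1 : 0 < m * u * (m * w + n * u - 2 * l * v) := by rw [key]; positivity
    exact pos_of_mul_pos_right h1 (by positivity)
  · subst h
    have hv : v = 0 := by
      have : v ^ 2 = 0 := by linarith
      exact pow_eq_zero_iff (two_ne_zero) |>.1 this
    subst hv
    have : 0 < m * w := mul_pos hm (by omega)
    linarith

/-- A vector orthogonal to the three basis vectors vanishes. -/
lemma orth_zero (x y z u v w a b c d e f : ℤ)
    (h1 : a * c - b ^ 2 = -1) (h2 : x * z - y ^ 2 = 0) (h3 : u * w - v ^ 2 = 0)
    (h4 : a * z + c * x - 2 * b * y = 0) (h5 : a * w + c * u - 2 * b * v = 0)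
    (h6 : x * w + z * u - 2 * y * v = 1)
    (k1 : d * z + f * x - 2 * e * y = 0) (k2 : d * w + f * u - 2 * e * v = 0)
    (k3 : d * c + f * a - 2 * e * b = 0) : d = 0 ∧ e = 0 ∧ f = 0 := by
  let M : Matrix (Fin 3) (Fin 3) ℤ := !![z, -2 * y, x; w, -2 * v, u; c, -2 * b, a]
  let N : Matrix (Fin 3) (Fin 3) ℤ := !![x, u, a; y, v, b; z, w, c]
  have hMN : M * N = !![0, 1, 0; 1, 0, 0; 0, 0, -2] := by
    ext i j
    fin_cases i <;> fin_cases j <;>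
      simp [M, N, Matrix.mul_apply, Fin.sum_univ_three] <;> linarith
  have hM : M.det ≠ 0 := by
    intro h
    have := congrArg Matrix.det hMN
    rw [Matrix.det_mul, h, zero_mul, Matrix.det_fin_three] at this
    simp at this
  have := Matrix.eq_zero_of_mulVec_eq_zero hM (v := ![d, e, f]) (by
    ext i
    fin_cases i <;> simp [M, Matrix.mulVec, dotProduct, Fin.sum_univ_three] <;> linarith)
  exact ⟨congrFun this 0, congrFun this 1, congrFun this 2⟩

/-- Given α ∈ L with det α = −1 and its associated lightlike pair α⁺, α⁻, every Λ ∈ L is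
uniquely Λ = p·α⁺ + q·α⁻ + r·α with p,q,r ∈ ℤ, det Λ = pq − r²; and if det Λ > 0 and
Tr Λ > 0 then p > 0, q > 0 and pq > r². -/
theorem stmt11 (α ap am : MZ)
    (hαs : α.IsSymm) (h00 : Even (α 0 0)) (h11 : Even (α 1 1)) (hαdet : α.det = -1)
    (hps : ap.IsSymm) (hms : am.IsSymm) (hpd : ap.det = 0) (hmd : am.det = 0)
    (hpt : 0 < ap.trace) (hmt : 0 < am.trace)
    (hop : BZ α ap = 0) (hom : BZ α am = 0) (hpm : BZ ap am = -1)
    (Λ : MZ) (hΛs : Λ.IsSymm) (hΛ00 : Even (Λ 0 0)) (hΛ11 : Even (Λ 1 1)) :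
    (∃! t : ℤ × ℤ × ℤ, Λ = t.1 • ap + t.2.1 • am + t.2.2 • α) ∧
    ∀ p q r : ℤ, Λ = p • ap + q • am + r • α →
      Λ.det = p * q - r ^ 2 ∧
      (0 < Λ.det → 0 < Λ.trace → 0 < p ∧ 0 < q ∧ r ^ 2 < p * q) := by
  have sα : α 1 0 = α 0 1 := hαs.apply 0 1
  have sp : ap 1 0 = ap 0 1 := hps.apply 0 1
  have sm : am 1 0 = am 0 1 := hms.apply 0 1
  have sΛ : Λ 1 0 = Λ 0 1 := hΛs.apply 0 1
  have ent : ∀ p q r : ℤ, Λ = p • ap + q • am + r • α ↔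
      (Λ 0 0 = p * ap 0 0 + q * am 0 0 + r * α 0 0 ∧
       Λ 0 1 = p * ap 0 1 + q * am 0 1 + r * α 0 1 ∧
       Λ 1 1 = p * ap 1 1 + q * am 1 1 + r * α 1 1) := by
    intro p q r
    constructor
    · intro h
      refine ⟨?_, ?_, ?_⟩
      · simpa [-zsmul_eq_mul] using congrFun (congrFun h 0) 0
      · simpa [-zsmul_eq_mul] using congrFun (congrFun h 0) 1
      · simpa [-zsmul_eq_mul] using congrFun (congrFun h 1) 1
    · rintro ⟨e1, e2, e3⟩
      ext i j
      fin_cases i <;> fin_cases j <;> simp [-zsmul_eq_mul, sα, sp, sm, sΛ, e1, e2, e3]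
  simp only [ent]
  rw [Matrix.det_fin_two] at hαdet hpd hmd ⊢
  rw [Matrix.trace_fin_two] at hpt hmt ⊢
  rw [sα] at hαdet
  rw [sp] at hpd
  rw [sm] at hmd
  rw [sΛ]
  unfold BZ at hop hom hpm
  clear ent hαs hps hms hΛs sα sp sm sΛ
  generalize α 0 0 = a, α 0 1 = b, α 1 1 = c, ap 0 0 = x, ap 0 1 = y, ap 1 1 = z,
    am 0 0 = u, am 0 1 = v, am 1 1 = w, Λ 0 0 = m, Λ 0 1 = l, Λ 1 1 = n at *
  obtain ⟨a', rfl⟩ := h00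
  obtain ⟨c', rfl⟩ := h11
  have hp : ∀ p q r : ℤ, (m = p * x + q * u + r * (a' + a') ∧ l = p * y + q * v + r * b ∧
      n = p * z + q * w + r * (c' + c')) → p = m * w + n * u - 2 * l * v ∧
      q = m * z + n * x - 2 * l * y ∧ r = l * b - m * c' - n * a' := by
    rintro p q r ⟨rfl, rfl, rfl⟩
    refine ⟨?_, ?_, ?_⟩
    · linear_combination p * hpm - 2 * q * hmd + r * hom
    · linear_combination q * hpm - 2 * p * hpd + r * hop
    · have : 2 * r = 2 * ((p * y + q * v + r * b) * b - (p * x + q * u + r * (a' + a')) * c'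
          - (p * z + q * w + r * (c' + c')) * a') := by
        linear_combination 2 * r * hαdet - p * hop - q * hom
      linarith
  refine ⟨⟨(m * w + n * u - 2 * l * v, m * z + n * x - 2 * l * y, l * b - m * c' - n * a'),
    ?_, ?_⟩, ?_⟩
  · have := orth_zero x y z u v w (a' + a') b (c' + c')
      (m - ((m * w + n * u - 2 * l * v) * x + (m * z + n * x - 2 * l * y) * u
        + (l * b - m * c' - n * a') * (a' + a')))
      (l - ((m * w + n * u - 2 * l * v) * y + (m * z + n * x - 2 * l * y) * v
        + (l * b - m * c' - n * a') * b))
      (n - ((m * w + n * u - 2 * l * v) * z + (m * z + n * x - 2 * l * y) * w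
        + (l * b - m * c' - n * a') * (c' + c')))
      (by linarith) (by linarith) (by linarith) (by linarith) (by linarith) (by linarith)
      (by linear_combination (m * z + n * x - 2 * l * y) * hpm
            - 2 * (m * w + n * u - 2 * l * v) * hpd + (l * b - m * c' - n * a') * hop)
      (by linear_combination (m * w + n * u - 2 * l * v) * hpm
            - 2 * (m * z + n * x - 2 * l * y) * hmd + (l * b - m * c' - n * a') * hom)
      (by linear_combination (m * w + n * u - 2 * l * v) * hop
            + (m * z + n * x - 2 * l * y) * hom - 2 * (l * b - m * c' - n * a') * hαdet)
    obtain ⟨e1, e2, e3⟩ := this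
    exact ⟨by linarith, by linarith, by linarith⟩
  · rintro ⟨p, q, r⟩ h
    obtain ⟨e1, e2, e3⟩ := hp p q r h
    simp only [← e1, ← e2, ← e3]
  · intro p q r h
    have hdet : m * n - l * l = p * q - r ^ 2 := by
      obtain ⟨rfl, rfl, rfl⟩ := h
      linear_combination p ^ 2 * hpd + q ^ 2 * hmd + r ^ 2 * hαdet - p * q * hpm
        - p * r * hop - q * r * hom
    refine ⟨hdet, fun hd ht => ?_⟩
    obtain ⟨e1, e2, -⟩ := hp p q r h
    refine ⟨?_, ?_, by linarith⟩
    · rw [e1]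
      exact pair_pos m l n u v w (by linarith) ht (by linarith) hmt
    · rw [e2]
      exact pair_pos m l n x y z (by linarith) ht (by linarith) hpt
end

section
/- Let k ≥ 1 be an integer and let f : ℤ → ℤ be a function with finite support satisfying the symmetry f(n) = f(2k − 2 − n) for all n ∈ ℤ. Then ∑_{n ≥ 0} (n+1)·f(n) − ∑_{n ≥ 0} (n+1)·f(n + 2k) = k · ∑_{n ∈ ℤ} f(n). -/
lemma finsum_pull (g : ℕ → ℤ) (hg : Function.Injective g) (h : ℤ → ℤ)
    (hs : ∀ m, m ∉ Set.range g → h m = 0) : ∑ᶠ n : ℕ, h (g n) = ∑ᶠ m : ℤ, h m := by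
  classical
  rw [← finsum_mem_range hg]
  apply finsum_congr
  intro m
  by_cases hm : m ∈ Set.range g
  · exact finsum_eq_if.trans (if_pos hm)
  · exact finsum_eq_if.trans ((if_neg hm).trans (hs m hm).symm)

/-- Wall-crossing identity: for k ≥ 1 and f : ℤ → ℤ of finite support with
f(n) = f(2k − 2 − n), one has
∑_{n≥0} (n+1)f(n) − ∑_{n≥0} (n+1)f(n+2k) = k·∑_{n∈ℤ} f(n). -/
theorem stmt12 (k : ℤ) (hk : 1 ≤ k) (f : ℤ → ℤ) (hf : (Function.support f).Finite)
    (hsymm : ∀ n : ℤ, f n = f (2 * k - 2 - n)) :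
    (∑ᶠ n : ℕ, ((n : ℤ) + 1) * f (n : ℤ)) - (∑ᶠ n : ℕ, ((n : ℤ) + 1) * f ((n : ℤ) + 2 * k))
      = k * ∑ᶠ n : ℤ, f n := by
  have fin : ∀ c : ℤ → ℤ, (Function.support (fun m => c m * f m)).Finite := fun c =>
    hf.subset (fun m hm => by
      simp only [Function.mem_support] at hm ⊢
      exact right_ne_zero_of_mul hm)
  have h1 : (∑ᶠ n : ℕ, ((n : ℤ) + 1) * f (n : ℤ)) = ∑ᶠ m : ℤ, max (m + 1) 0 * f m := by
    rw [← finsum_pull (fun n => (n : ℤ)) Nat.cast_injective (fun m => max (m + 1) 0 * f m)]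
    · apply finsum_congr
      intro n
      rw [max_eq_left (by positivity)]
    · intro m hm
      have : m + 1 ≤ 0 := by
        by_contra hc
        exact hm ⟨m.toNat, by simp only []; omega⟩
      simp only [max_eq_right this, zero_mul]
  have h2 : (∑ᶠ n : ℕ, ((n : ℤ) + 1) * f ((n : ℤ) + 2 * k))
      = ∑ᶠ m : ℤ, max (-(m + 1)) 0 * f m := by
    rw [← finsum_pull (fun n => -2 - (n : ℤ)) (fun a b h => by simp only [] at h; omega)
      (fun m => max (-(m + 1)) 0 * f m)]
    · apply finsum_congr
      intro n
      rw [hsymm (n + 2 * k), max_eq_left (by omega)]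
      congr 1
      · ring
      · congr 1; ring
    · intro m hm
      have : -(m + 1) ≤ 0 := by
        by_contra hc
        exact hm ⟨(-2 - m).toNat, by simp only []; omega⟩
      simp only [max_eq_right this, zero_mul]
  have h3 : (∑ᶠ m : ℤ, (m + 1) * f m) = ∑ᶠ m : ℤ, (2 * k - 1 - m) * f m := by
    rw [← finsum_comp_equiv (Equiv.subLeft (2 * k - 2))]
    apply finsum_congr
    intro m
    simp only [Equiv.subLeft_apply]
    rw [← hsymm m]
    ring
  have h4 : (∑ᶠ m : ℤ, (m + 1) * f m) + ∑ᶠ m : ℤ, (2 * k - 1 - m) * f m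
      = 2 * k * ∑ᶠ m : ℤ, f m := by
    rw [← finsum_add_distrib (fin _) (fin _), mul_finsum]
    apply finsum_congr
    intro m
    ring
  rw [h1, h2, ← finsum_sub_distrib (fin _) (fin _)]
  have h5 : (∑ᶠ m : ℤ, (max (m + 1) 0 * f m - max (-(m + 1)) 0 * f m))
      = ∑ᶠ m : ℤ, (m + 1) * f m := by
    apply finsum_congr
    intro m
    rw [← sub_mul]
    congr 1
    omega
  rw [h5]
  linarith
end

section
/- Let P, Q ∈ ℤⁿ be such that the greatest common divisor of all the 2×2 minors P_a Q_b − P_b Q_a (over 1 ≤ a < b ≤ n) equals 1. Suppose P = P₁ + P₂ and Q = Q₁ + Q₂ with P₁, Q₁, P₂, Q₂ ∈ ℤⁿ, where the pair (P₁, Q₁) has all 2×2 minors zero (i.e. P₁ and Q₁ are proportional), the pair (P₂, Q₂) has all 2×2 minors zero, and (P₁,Q₁) ≠ (0,0) ≠ (P₂,Q₂). Then there exist integers a, b, c, d with ad − bc = ε ∈ {+1, −1} such that P₁ = ε·b·(−cP + dQ), Q₁ = ε·a·(−cP + dQ), P₂ = ε·d·(aP − bQ), and Q₂ = ε·c·(aP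 − bQ). -/
theorem rank_one_factor {n : ℕ} (P Q : Fin n → ℤ)
    (h : ∀ a b : Fin n, P a * Q b - P b * Q a = 0) (hne : ¬(P = 0 ∧ Q = 0)) :
    ∃ (a b : ℤ) (v : Fin n → ℤ), (∀ j, P j = b * v j) ∧ (∀ j, Q j = a * v j) := by
  obtain ⟨k, hk⟩ : ∃ k, ¬(P k = 0 ∧ Q k = 0) := by
    by_contra hc
    push Not at hc
    exact hne ⟨funext fun k => (hc k).1, funext fun k => (hc k).2⟩
  have hg : (Int.gcd (P k) (Q k) : ℤ) ≠ 0 := by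
    intro h0
    exact hk (Int.gcd_eq_zero_iff.mp (by exact_mod_cast h0))
  obtain ⟨b, hb⟩ := Int.gcd_dvd_left (P k) (Q k)
  obtain ⟨a, ha⟩ := Int.gcd_dvd_right (P k) (Q k)
  have hbez := Int.gcd_eq_gcd_ab (P k) (Q k)
  generalize (Int.gcd (P k) (Q k) : ℤ) = g at *
  generalize Int.gcdA (P k) (Q k) = x at *
  generalize Int.gcdB (P k) (Q k) = y at *
  have h1 : b * x + a * y = 1 := by
    apply mul_left_cancel₀ hg
    rw [hb, ha] at hbez
    linear_combination -hbez
  have h2 : ∀ j, P j * a = Q j * b := by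
    intro j
    apply mul_left_cancel₀ hg
    have := h j k
    rw [hb, ha] at this
    linear_combination this
  refine ⟨a, b, fun j => x * P j + y * Q j, fun j => ?_, fun j => ?_⟩
  · linear_combination (-P j) * h1 + y * h2 j
  · linear_combination (-Q j) * h1 - x * h2 j

/-- If (P,Q) satisfies the co-prime condition gcd(P_aQ_b − P_bQ_a) = 1 and splits as a
sum of two nonzero 1/2-BPS charges (each with proportional electric and magnetic parts),
then the splitting comes from an element of PGL(2,ℤ):
P₁ = εb(−cP+dQ), Q₁ = εa(−cP+dQ), P₂ = εd(aP−bQ), Q₂ = εc(aP−bQ) with ad − bc = ε = ±1. -/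
theorem stmt14 {n : ℕ} (P Q P₁ Q₁ P₂ Q₂ : Fin n → ℤ)
    (hgcd : Finset.univ.gcd
      (fun ab : Fin n × Fin n => P ab.1 * Q ab.2 - P ab.2 * Q ab.1) = 1)
    (hsplitP : P = P₁ + P₂) (hsplitQ : Q = Q₁ + Q₂)
    (h1 : ∀ a b : Fin n, P₁ a * Q₁ b - P₁ b * Q₁ a = 0)
    (h2 : ∀ a b : Fin n, P₂ a * Q₂ b - P₂ b * Q₂ a = 0)
    (hne1 : ¬(P₁ = 0 ∧ Q₁ = 0)) (hne2 : ¬(P₂ = 0 ∧ Q₂ = 0)) :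
    ∃ a b c d ε : ℤ, (ε = 1 ∨ ε = -1) ∧ a * d - b * c = ε ∧
      P₁ = (ε * b) • (-(c • P) + d • Q) ∧
      Q₁ = (ε * a) • (-(c • P) + d • Q) ∧
      P₂ = (ε * d) • (a • P - b • Q) ∧
      Q₂ = (ε * c) • (a • P - b • Q) := by
  obtain ⟨a, b, v, hP1, hQ1⟩ := rank_one_factor P₁ Q₁ h1 hne1
  obtain ⟨c, d, w, hP2, hQ2⟩ := rank_one_factor P₂ Q₂ h2 hne2
  have hdvd : (a * d - b * c) ∣ 1 := by
    rw [← hgcd]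
    apply Finset.dvd_gcd
    rintro ⟨i, j⟩ -
    refine ⟨-(v i * w j - v j * w i), ?_⟩
    simp only [hsplitP, hsplitQ, Pi.add_apply, hP1, hP2, hQ1, hQ2]
    ring
  have hu := Int.isUnit_iff.mp (isUnit_of_dvd_one hdvd)
  have hsq : (a * d - b * c) * (a * d - b * c) = 1 := by
    rcases hu with h | h <;> rw [h] <;> norm_num
  refine ⟨a, b, c, d, a * d - b * c, hu, rfl, ?_, ?_, ?_, ?_⟩ <;> funext j <;>
    simp only [hsplitP, hsplitQ, Pi.add_apply, Pi.smul_apply, Pi.neg_apply, Pi.sub_apply,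
      smul_eq_mul, hP1, hP2, hQ1, hQ2]
  · linear_combination (-b * v j) * hsq
  · linear_combination (-a * v j) * hsq
  · linear_combination (-d * w j) * hsq
  · linear_combination (-c * w j) * hsq
end
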